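/- Every finite-dimensional C*-algebra over ℂ is *-isomorphic to a finite direct sum of full complex matrix algebras: if 𝔄 is a C*-algebra over ℂ that is finite-dimensional as a complex vector space, then there exist k ∈ ℕ and positive integers n₁,…,n_k such that 𝔄 is isomorphic, as a star algebra over ℂ, to the product algebra Π_{i=1}^{k} M_{n_i}(ℂ). In particular every finite-dimensional C*-algebra is unital. -/

import Mathlib

open Matrix

lemma NonUnitalCStarAlgebra.exists_one_of_finiteDimensional (A : Type*) [NonUnitalCStarAlgebra A]
    [FiniteDimensional ℂ A] : ∃ e : A, ∀ a, e * a = a ∧ a * e = a := by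
  let _ := CStarAlgebra.spectralOrder A
  have _ := CStarAlgebra.spectralOrderedRing A
  have _ := FiniteDimensional.proper ℂ A
  have hl := CStarAlgebra.increasingApproximateUnit A
  obtain ⟨e, -, he⟩ := (isCompact_closedBall (0 : A) 1).exists_clusterPt
    (Filter.le_principal_iff.2 hl.closedBall_mem)
  have : (nhds e ⊓ CStarAlgebra.approximateUnit A).NeBot := he
  refine ⟨e, fun a => ⟨?_, ?_⟩⟩
  · exact tendsto_nhds_unique (((continuous_mul_const a).tendsto e).mono_left inf_le_left)
      ((hl.tendsto_mul_right a).mono_left inf_le_right)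
  · exact tendsto_nhds_unique (((continuous_const_mul a).tendsto e).mono_left inf_le_left)
      ((hl.tendsto_mul_left a).mono_left inf_le_right)

/-- A non-unital C⋆-algebra containing a two-sided identity element is a C⋆-algebra. -/
noncomputable abbrev NonUnitalCStarAlgebra.toCStarAlgebra {A : Type*} [i : NonUnitalCStarAlgebra A] (e : A)
    (he : ∀ a, e * a = a ∧ a * e = a) : CStarAlgebra A :=
  let _ : NormedRing A :=
    { i.toNonUnitalNormedRing with
      one := e
      one_mul := fun a => (he a).1
      mul_one := fun a => (he a).2 }
  { ‹NormedRing A›, i with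
    toAlgebra := Algebra.ofModule (fun r x y => smul_mul_assoc r x y)
      (fun r x y => mul_smul_comm r x y)
    norm_smul_le := norm_smul_le }

section Positive
open scoped ComplexOrder
variable {A : Type*} [CStarAlgebra A]

lemma CStarAlgebra.nonneg_of_mem_spectrum_star_mul_self {a : A} {z : ℂ}
    (hz : z ∈ spectrum ℂ (star a * a)) : 0 ≤ z := by
  let _ := CStarAlgebra.spectralOrder A
  have _ := CStarAlgebra.spectralOrderedRing A
  exact spectrum_nonneg_of_nonneg (star_mul_self_nonneg a) hz

lemma IsSelfAdjoint.eq_zero_of_isNilpotent {c : A} (hc : IsSelfAdjoint c) (h : IsNilpotent c) :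
    c = 0 := by
  obtain ⟨n, hn⟩ := h
  have h2 : c ^ 2 ^ n = 0 := pow_eq_zero_of_le Nat.lt_two_pow_self.le hn
  have := hc.nnnorm_pow_two_pow n
  rw [h2, nnnorm_zero] at this
  exact nnnorm_eq_zero.1 (pow_eq_zero_iff (by positivity) |>.1 this.symm)

/-- A finite-dimensional C⋆-algebra has trivial Jacobson radical, since the radical is nilpotent
and no nonzero `star a * a` is. -/
lemma CStarAlgebra.isSemisimpleRing [FiniteDimensional ℂ A] : IsSemisimpleRing A := by
  have := IsArtinianRing.of_finite ℂ A
  rw [IsArtinianRing.isSemisimpleRing_iff_jacobson, eq_bot_iff]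
  intro a ha
  obtain ⟨n, hn⟩ := IsSemiprimaryRing.isNilpotent (R := A)
  have h : star a * a ∈ Ring.jacobson A := Ideal.mul_mem_left _ _ ha
  have h2 : (star a * a) ^ n ∈ (Ring.jacobson A) ^ n := Ideal.pow_mem_pow h n
  rw [hn] at h2
  exact CStarRing.star_mul_self_eq_zero_iff a |>.1
    ((IsSelfAdjoint.star_mul_self a).eq_zero_of_isNilpotent ⟨n, h2⟩)

lemma CStarAlgebra.trace_lmul_star_mul_self_pos [FiniteDimensional ℂ A] {a : A} (ha : a ≠ 0) :
    0 < LinearMap.trace ℂ A (Algebra.lmul ℂ A (star a * a)) := by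
  set T := Algebra.lmul ℂ A (star a * a) with hT
  have hs : T.charpoly.Splits := IsAlgClosed.splits _
  have hr : ∀ z ∈ T.charpoly.roots, 0 ≤ z := fun z hz => by
    have := (Module.End.hasEigenvalue_iff_isRoot_charpoly T z).2 (Polynomial.isRoot_of_mem_roots hz)
    exact nonneg_of_mem_spectrum_star_mul_self
      (AlgHom.spectrum_apply_subset (Algebra.lmul ℂ A) _ this.mem_spectrum)
  rw [Module.End.trace_eq_sum_roots_charpoly_of_splits hs]
  refine (Multiset.sum_nonneg hr).lt_of_ne' fun h0 => ha ?_
  have hz : ∀ z ∈ T.charpoly.roots, z = 0 := fun z hz =>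
    ((Multiset.single_le_sum hr z hz).trans h0.le).antisymm (hr z hz)
  have hX : T.charpoly = Polynomial.X ^ T.charpoly.roots.card := by
    conv_lhs => rw [hs.eq_prod_roots_of_monic T.charpoly_monic, Multiset.eq_replicate_card.2 hz]
    simp
  have hT0 := T.aeval_self_charpoly
  rw [hX, map_pow, Polynomial.aeval_X, hT, ← map_pow] at hT0
  exact CStarRing.star_mul_self_eq_zero_iff a |>.1
    ((IsSelfAdjoint.star_mul_self a).eq_zero_of_isNilpotent
      ⟨_, Algebra.lmul_injective (hT0.trans (map_zero _).symm)⟩)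

end Positive

section Form
open scoped ComplexOrder
variable {A : Type*} [Ring A] [StarRing A] [Algebra ℂ A] [StarModule ℂ A] {f : A →ₗ[ℂ] ℂ}

lemma LinearMap.apply_star_mul_eq_conj (hf : ∀ a, a ≠ 0 → 0 < f (star a * a)) (a b : A) :
    f (star a * b) = star (f (star b * a)) := by
  have him : ∀ c, (f (star c * c)).im = 0 := fun c => by
    by_cases hc : c = 0
    · simp [hc]
    · exact (Complex.pos_iff.1 (hf c hc)).2.symm
  have h1 := him (a + b)
  have h2 := him (a + Complex.I • b)
  have ha := him a
  have hb := him b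
  simp [add_mul, mul_add, ha, hb] at h1 h2
  apply Complex.ext <;> simp <;> linarith

open scoped MatrixOrder Matrix.Norms.L2Operator in
/-- A matrix representation that embeds in the left regular one is equivalent to a
⋆-representation as soon as there is a faithful positive functional. -/
lemma AlgHom.exists_units_conj_map_star {n : Type*} [Fintype n] [DecidableEq n]
    (hf : ∀ a, a ≠ 0 → 0 < f (star a * a))
    (π : A →ₐ[ℂ] Matrix n n ℂ) (ι : (n → ℂ) →ₗ[ℂ] A) (hι : Function.Injective ι)
    (h : ∀ a v, ι (π a *ᵥ v) = a * ι v) :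
    ∃ S : (Matrix n n ℂ)ˣ, ∀ a, S * π (star a) * (S⁻¹ : (Matrix n n ℂ)ˣ) =
      star (S * π a * (S⁻¹ : (Matrix n n ℂ)ˣ)) := by
  let T : Matrix n n ℂ := .of fun k l => f (star (ι (Pi.single k 1)) * ι (Pi.single l 1))
  have hT : ∀ x y, star x ⬝ᵥ T *ᵥ y = f (star (ι x) * ι y) := fun x y => by
    have hx : ∀ x : n → ℂ, ι x = ∑ k, x k • ι (Pi.single k 1) := fun x => by
      rw [LinearMap.pi_apply_eq_sum_univ ι x]
      congr! with i _ j
      simp [Pi.single_apply, eq_comm]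
    rw [hx x, hx y]
    simp only [dotProduct, mulVec, T, Finset.sum_mul, Finset.mul_sum, star_sum, star_smul,
      smul_mul_smul_comm, map_sum, map_smul, of_apply, Pi.star_apply, smul_eq_mul]
    rw [Finset.sum_comm]
    exact Finset.sum_congr rfl fun i _ => Finset.sum_congr rfl fun j _ => by ring
  have hpos : T.PosDef := by
    refine .of_dotProduct_mulVec_pos ?_ fun x hx => ?_
    · ext k l
      exact (LinearMap.apply_star_mul_eq_conj hf _ _).symm
    · rw [hT]
      exact hf _ ((map_ne_zero_iff ι hι).2 hx)
  have hcomm : ∀ a, star (π a) * T = T * π (star a) := fun a => by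
    have key : ∀ x y, star x ⬝ᵥ (star (π a) * T) *ᵥ y = star x ⬝ᵥ (T * π (star a)) *ᵥ y :=
      fun x y => by
      rw [← mulVec_mulVec, ← mulVec_mulVec, hT, h, dotProduct_mulVec, star_eq_conjTranspose,
        ← star_mulVec, hT, h, star_mul, mul_assoc]
    ext k l
    simpa [star_eq_conjTranspose] using key (Pi.single k 1) (Pi.single l 1)
  obtain ⟨_, ⟨S, rfl⟩, hS⟩ :=
    CStarAlgebra.isStrictlyPositive_iff_eq_star_mul_self.1 hpos.isStrictlyPositive
  refine ⟨S, fun a => ?_⟩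
  have := hcomm a
  rw [hS] at this
  have h1 : (star (S : Matrix n n ℂ)) * star (((S⁻¹ : (Matrix n n ℂ)ˣ)) : Matrix n n ℂ) = 1 := by
    rw [← star_mul]; simp
  have h2 : star (((S⁻¹ : (Matrix n n ℂ)ˣ)) : Matrix n n ℂ) * (star (S : Matrix n n ℂ)) = 1 := by
    rw [← star_mul]; simp
  have h3 : (S : Matrix n n ℂ) * ((S⁻¹ : (Matrix n n ℂ)ˣ) : Matrix n n ℂ) = 1 := by simp
  generalize ((S⁻¹ : (Matrix n n ℂ)ˣ) : Matrix n n ℂ) = R at *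
  generalize (S : Matrix n n ℂ) = Q at *
  rw [star_mul, star_mul]
  calc Q * π (star a) * R = star R * star Q * Q * π (star a) * R := by rw [h2, one_mul]
    _ = star R * (star Q * Q * π (star a)) * R := by noncomm_ring
    _ = star R * (star (π a) * star Q) * (Q * R) := by rw [← this]; noncomm_ring
    _ = _ := by rw [h3, mul_one]
end Form

/-- The structure theorem for unital finite-dimensional C⋆-algebras. -/
theorem CStarAlgebra.exists_starAlgEquiv_pi_matrix (A : Type*) [CStarAlgebra A]
    [FiniteDimensional ℂ A] :
    ∃ (k : ℕ) (n : Fin k → ℕ), (∀ i, 0 < n i) ∧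
      Nonempty (A ≃⋆ₐ[ℂ] (∀ i : Fin k, Matrix (Fin (n i)) (Fin (n i)) ℂ)) := by
  have := CStarAlgebra.isSemisimpleRing (A := A)
  obtain ⟨k, n, hn, ⟨ψ⟩⟩ := IsSemisimpleRing.exists_algEquiv_pi_matrix_of_isAlgClosed ℂ A
  refine ⟨k, n, fun i => Nat.pos_of_neZero _, ?_⟩
  have key : ∀ i, ∃ S : (Matrix (Fin (n i)) (Fin (n i)) ℂ)ˣ, ∀ a,
      S * ψ (star a) i * (S⁻¹ : (Matrix (Fin (n i)) (Fin (n i)) ℂ)ˣ) =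
      star (S * ψ a i * (S⁻¹ : (Matrix (Fin (n i)) (Fin (n i)) ℂ)ˣ)) := fun i => by
    let col : (Fin (n i) → ℂ) →ₗ[ℂ] Matrix (Fin (n i)) (Fin (n i)) ℂ :=
      { toFun := fun v => vecMulVec v (Pi.single 0 1)
        map_add' := fun v w => add_vecMulVec _ _ _
        map_smul' := fun c v => smul_vecMulVec _ _ _ }
    let ι : (Fin (n i) → ℂ) →ₗ[ℂ] A := ψ.symm.toLinearMap ∘ₗ LinearMap.single ℂ _ i ∘ₗ col
    have hcol : Function.Injective col := fun v w hvw => by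
      ext j
      simpa [col, vecMulVec_apply] using congr_fun₂ hvw j 0
    refine AlgHom.exists_units_conj_map_star
      (f := LinearMap.trace ℂ A ∘ₗ (Algebra.lmul ℂ A).toLinearMap)
      (fun a ha => CStarAlgebra.trace_lmul_star_mul_self_pos ha)
      ((Pi.evalAlgHom ℂ _ i).comp ψ.toAlgHom) ι
      (ψ.symm.injective.comp ((Pi.single_injective i).comp hcol)) fun a v => ?_
    apply ψ.injective
    have : col (ψ a i *ᵥ v) = ψ a i * col v := (mul_vecMulVec _ _ _).symm
    simp [ι, this, Pi.single_mul_right]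
  choose S hS using key
  let conj (i : Fin k) :
      Matrix (Fin (n i)) (Fin (n i)) ℂ ≃ₐ[ℂ] Matrix (Fin (n i)) (Fin (n i)) ℂ :=
    MulSemiringAction.toAlgEquiv ℂ _ (ConjAct.toConjAct (S i))
  exact ⟨StarAlgEquiv.ofAlgEquiv (ψ.trans (AlgEquiv.piCongrRight conj)) fun a =>
    funext fun i => hS i a⟩

/-- **Structure theorem for finite-dimensional C*-algebras.**
Every C*-algebra over ℂ (a complex Banach *-algebra whose norm satisfies
`‖A‖² = ‖A* A‖`, here not assumed unital) which is finite-dimensional as a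
complex vector space is isomorphic, as a star algebra over ℂ, to a finite
direct sum (product) of full complex matrix algebras `Π i, M_{n i}(ℂ)` with
all `n i` positive.  In particular every finite-dimensional C*-algebra is
unital, since the product of matrix algebras is. -/
theorem structure_theorem_finite_dimensional_CStarAlgebra
    (𝔄 : Type*) [NonUnitalNormedRing 𝔄] [StarRing 𝔄] [CStarRing 𝔄]
    [NormedSpace ℂ 𝔄] [IsScalarTower ℂ 𝔄 𝔄] [SMulCommClass ℂ 𝔄 𝔄]
    [StarModule ℂ 𝔄] [CompleteSpace 𝔄] [FiniteDimensional ℂ 𝔄] :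
    ∃ (k : ℕ) (n : Fin k → ℕ), (∀ i, 0 < n i) ∧
      Nonempty (𝔄 ≃⋆ₐ[ℂ] (∀ i : Fin k, Matrix (Fin (n i)) (Fin (n i)) ℂ)) := by
  let _ : NonUnitalCStarAlgebra 𝔄 := { }
  obtain ⟨e, he⟩ := NonUnitalCStarAlgebra.exists_one_of_finiteDimensional 𝔄
  let i : CStarAlgebra 𝔄 := NonUnitalCStarAlgebra.toCStarAlgebra e he
  have : @FiniteDimensional ℂ 𝔄 _ _ i.toNormedAlgebra.toAlgebra.toModule :=
    ‹FiniteDimensional ℂ 𝔄›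
  exact CStarAlgebra.exists_starAlgEquiv_pi_matrix 𝔄
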